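/- Let E be a real Banach space, let x, x₁ ∈ E, let L ≥ 0, and let v : E → ℝ → E be a vector field such that for every t ∈ [0,1] the map y ↦ v y t is L-Lipschitz and such that (y,t) ↦ v y t is continuous. Define the exact path x_t = (1−t)·x + t·x₁ and the drift error e(t) = v (x_t) t − (x₁ − x), and let x̃ : [0,1] → E be differentiable with x̃'(t) = v (x̃ t) t for all t ∈ [0,1] and x̃(1) = x₁. Fix τ ∈ (0,1] and define the one-step reconstruction x̂ = x̃(τ) − τ · v (x̃ τ) τ. Then ‖x̂ − x‖ ≤ (τ·L + 1)·exp(L·(1−τ)) · ∫_τ^1 ‖e(t)‖ dt + τ·‖e(τ)‖. -/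

import Mathlib

open Set intervalIntegral

/-- **Grönwall's inequality** with a variable inhomogeneity: if `f 0 = 0` and
`‖f' s‖ ≤ K * ‖f s‖ + g s`, then `‖f s‖ ≤ exp (K * s) * ∫ u in 0..s, g u`. -/
theorem norm_le_exp_mul_integral_of_norm_deriv_right_le
    {E : Type*} [NormedAddCommGroup E] [NormedSpace ℝ E]
    {f f' : ℝ → E} {g : ℝ → ℝ} {K b : ℝ} (hK : 0 ≤ K)
    (hf : ContinuousOn f (Icc 0 b))
    (hf' : ∀ s ∈ Ico 0 b, HasDerivWithinAt f (f' s) (Ici s) s)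
    (hf0 : f 0 = 0) (hg : Continuous g) (hg0 : ∀ s, 0 ≤ g s)
    (bound : ∀ s ∈ Ico 0 b, ‖f' s‖ ≤ K * ‖f s‖ + g s) {s : ℝ} (hs : s ∈ Icc 0 b) :
    ‖f s‖ ≤ Real.exp (K * s) * ∫ u in (0 : ℝ)..s, g u := by
  have key : ∀ ε > 0, ‖f s‖ ≤
      Real.exp (K * s) * ((∫ u in (0 : ℝ)..s, g u) + ε * (1 + s)) := by
    intro ε hε
    have hB : ∀ r : ℝ, HasDerivAt
        (fun r => Real.exp (K * r) * ((∫ u in (0 : ℝ)..r, g u) + ε * (1 + r)))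
        (Real.exp (K * r) * K * ((∫ u in (0 : ℝ)..r, g u) + ε * (1 + r)) +
          Real.exp (K * r) * (g r + ε)) r := by
      intro r
      have h₁ : HasDerivAt (fun r => Real.exp (K * r)) (Real.exp (K * r) * K) r := by
        simpa using ((hasDerivAt_id r).const_mul K).exp
      have h₂ : HasDerivAt (fun r => ∫ u in (0 : ℝ)..r, g u) (g r) r :=
        hg.integral_hasStrictDerivAt 0 r |>.hasDerivAt
      have h₃ : HasDerivAt (fun r : ℝ => ε * (1 + r)) ε r := by
        simpa using ((hasDerivAt_id r).const_add 1).const_mul ε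
      exact h₁.mul (h₂.add h₃)
    refine image_norm_le_of_norm_deriv_right_lt_deriv_boundary hf hf' ?_ hB ?_ hs
    · simp [hf0, hε.le]
    · intro r hr hfr
      have h₁ : 1 ≤ Real.exp (K * r) := Real.one_le_exp (mul_nonneg hK hr.1)
      have h₂ := bound r hr
      rw [hfr] at h₂
      nlinarith [mul_le_mul_of_nonneg_right h₁ (add_nonneg (hg0 r) hε.le)]
  have hlim : Filter.Tendsto
      (fun ε : ℝ => Real.exp (K * s) * ((∫ u in (0 : ℝ)..s, g u) + ε * (1 + s)))
      (nhdsWithin 0 (Ioi 0)) (nhds (Real.exp (K * s) * ∫ u in (0 : ℝ)..s, g u)) := by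
    have hc : Continuous
        (fun ε : ℝ => Real.exp (K * s) * ((∫ u in (0 : ℝ)..s, g u) + ε * (1 + s))) := by
      fun_prop
    simpa using (hc.tendsto 0).mono_left nhdsWithin_le_nhds
  exact ge_of_tendsto hlim (by filter_upwards [self_mem_nhdsWithin] with ε hε using key ε hε)

/-- Proposition 1: error bound for the one-step reconstruction after early stopping
of the flow ODE at time `τ`. -/
theorem early_stopping_error_bound
    {E : Type*} [NormedAddCommGroup E] [NormedSpace ℝ E] [CompleteSpace E]
    (x x₁ : E) (L : ℝ) (hL : 0 ≤ L)
    (v : E → ℝ → E)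
    (hlip : ∀ t ∈ Set.Icc (0:ℝ) 1, LipschitzWith (Real.toNNReal L) (fun y => v y t))
    (hcont : Continuous (fun p : E × ℝ => v p.1 p.2))
    (xt : ℝ → E) (hxt : ∀ t, xt t = (1 - t) • x + t • x₁)
    (e : ℝ → E) (he : ∀ t, e t = v (xt t) t - (x₁ - x))
    (xtil : ℝ → E)
    (hode : ∀ t ∈ Set.Icc (0:ℝ) 1, HasDerivAt xtil (v (xtil t) t) t)
    (hend : xtil 1 = x₁)
    (τ : ℝ) (hτ : τ ∈ Set.Ioc (0:ℝ) 1)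
    (xhat : E) (hxhat : xhat = xtil τ - τ • v (xtil τ) τ) :
    ‖xhat - x‖ ≤
      (τ * L + 1) * Real.exp (L * (1 - τ)) * (∫ t in τ..1, ‖e t‖) + τ * ‖e τ‖ := by
  obtain ⟨hτ0, hτ1⟩ := hτ
  have hxt_cont : Continuous xt := by
    rw [funext hxt]
    fun_prop
  have he_cont : Continuous e := by
    rw [funext he]
    exact (hcont.comp (hxt_cont.prodMk continuous_id)).sub continuous_const
  have hxt_deriv : ∀ t, HasDerivAt xt (x₁ - x) t := by
    intro t
    rw [funext hxt]
    have h := (((hasDerivAt_id' t).const_sub 1).smul_const x).fun_add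
      ((hasDerivAt_id' t).smul_const x₁)
    rwa [neg_one_smul, one_smul, neg_add_eq_sub] at h
  have hv : ∀ t ∈ Icc (0 : ℝ) 1, ‖v (xtil t) t - v (xt t) t‖ ≤ L * ‖xtil t - xt t‖ := by
    intro t ht
    simpa [Real.coe_toNNReal L hL] using (hlip t ht).norm_sub_le (xtil t) (xt t)
  have hderiv : ∀ s ∈ Icc (0 : ℝ) 1, HasDerivAt (fun s => xtil (1 - s) - xt (1 - s))
      (-(v (xtil (1 - s)) (1 - s) - (x₁ - x))) s := by
    intro s hs
    have h₁ := (hode (1 - s) ⟨by linarith [hs.2], by linarith [hs.1]⟩).sub (hxt_deriv (1 - s))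
    exact h₁.comp_const_sub 1 s
  have hδ : ‖xtil τ - xt τ‖ ≤ Real.exp (L * (1 - τ)) * ∫ t in τ..1, ‖e t‖ := by
    have h := norm_le_exp_mul_integral_of_norm_deriv_right_le
      (g := fun s => ‖e (1 - s)‖) (s := 1 - τ) (b := 1) hL
      (fun s hs => (hderiv s hs).continuousAt.continuousWithinAt)
      (fun s hs => (hderiv s (Ico_subset_Icc_self hs)).hasDerivWithinAt)
      (by simp [hend, hxt]) (by fun_prop) (fun s => norm_nonneg _)
      (fun s hs => ?_) ⟨by linarith, by linarith⟩
    · simpa [integral_comp_sub_left (fun t => ‖e t‖)] using h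
    · have hsplit : v (xtil (1 - s)) (1 - s) - (x₁ - x) =
          (v (xtil (1 - s)) (1 - s) - v (xt (1 - s)) (1 - s)) + e (1 - s) := by
        rw [he]
        abel
      rw [norm_neg, hsplit]
      exact (norm_add_le _ _).trans
        (by gcongr; exact hv _ ⟨by linarith [hs.2], by linarith [hs.1]⟩)
  have hdecomp : xhat - x =
      (xtil τ - xt τ) - τ • (v (xtil τ) τ - v (xt τ) τ) - τ • e τ := by
    rw [hxhat, he, hxt]
    module
  calc ‖xhat - x‖
      ≤ ‖xtil τ - xt τ‖ + τ * ‖v (xtil τ) τ - v (xt τ) τ‖ + τ * ‖e τ‖ := by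
        rw [hdecomp]
        refine (norm_sub_le _ _).trans ?_
        rw [norm_smul, Real.norm_of_nonneg hτ0.le]
        gcongr
        refine (norm_sub_le _ _).trans ?_
        rw [norm_smul, Real.norm_of_nonneg hτ0.le]
    _ ≤ ‖xtil τ - xt τ‖ + τ * (L * ‖xtil τ - xt τ‖) + τ * ‖e τ‖ := by
        gcongr
        exact hv τ ⟨hτ0.le, hτ1⟩
    _ = (τ * L + 1) * ‖xtil τ - xt τ‖ + τ * ‖e τ‖ := by ring
    _ ≤ (τ * L + 1) * Real.exp (L * (1 - τ)) * (∫ t in τ..1, ‖e t‖) + τ * ‖e τ‖ := by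
        rw [mul_assoc]
        gcongr
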